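/- For all integers g ≥ δ ≥ 0, the identity of formal power series ∑_{d=0}^∞ E(g,δ,d) · y^d = (1−y)^{2g−2} · (1 + y·(1−y)^{−2})^δ holds in ℚ[[y]], where negative powers of (1−y) are interpreted via the inverse of the unit 1−y in ℚ[[y]]. -/

import Mathlib

open PowerSeries Finset

/-- Generalized binomial coefficient `C(a, k) = a(a-1)⋯(a-k+1)/k!` for an
integer `a` and a natural number `k`, as a rational number. -/
def genChoose (a : ℤ) (k : ℕ) : ℚ :=
  (∏ j ∈ Finset.range k, ((a : ℚ) - j)) / (Nat.factorial k)

/-- `ǩ(λ) = δ₂ + δ₃ + ⋯ + δ_d`, the number of parts of `λ ⊢ d` that are at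
least `2` (here `δ_ℓ` is the multiplicity of `ℓ` in `λ`). -/
def kcheck (d : ℕ) (lam : Nat.Partition d) : ℕ :=
  ∑ ℓ ∈ Finset.Icc 2 d, lam.parts.count ℓ

/-- `A_λ = ∏_{ℓ=2}^d (ℓ-1)^{δ_ℓ}` (equal to `1` when `d ≤ 1`). -/
def Apart (d : ℕ) (lam : Nat.Partition d) : ℚ :=
  ∏ ℓ ∈ Finset.Icc 2 d, ((ℓ : ℚ) - 1) ^ (lam.parts.count ℓ)

/-- `E(g,δ,d) = ∑_{λ ⊢ d, ǩ(λ) ≤ δ} A_λ · δ!/((δ-ǩ(λ))! δ₂!⋯δ_d!) ·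
C(δ₁+1+δ-ǩ(λ)-2g, δ₁)`, the Euler characteristic `χ(C^{[d]}_{g,δ})` of the
Hilbert scheme of `d` points on an integral `δ`-nodal curve of arithmetic
genus `g`. -/
def E (g δ d : ℕ) : ℚ :=
  ∑ lam : Nat.Partition d,
    if kcheck d lam ≤ δ then
      Apart d lam *
        ((Nat.factorial δ : ℚ) /
          ((Nat.factorial (δ - kcheck d lam) : ℚ) *
            ∏ ℓ ∈ Finset.Icc 2 d, (Nat.factorial (lam.parts.count ℓ) : ℚ))) *
        genChoose ((lam.parts.count 1 : ℤ) + 1 + δ - kcheck d lam - 2 * g)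
          (lam.parts.count 1)
    else 0

theorem genChoose_add_one_succ (a : ℤ) (k : ℕ) :
    genChoose (a + 1) (k + 1) = genChoose a k + genChoose a (k + 1) := by
  have hk : (Nat.factorial k : ℚ) ≠ 0 := by positivity
  have hk' : (k : ℚ) + 1 ≠ 0 := by positivity
  have hprod : ∏ j ∈ range k, (((a + 1 : ℤ) : ℚ) - ((j + 1 : ℕ) : ℚ)) =
      ∏ j ∈ range k, ((a : ℚ) - j) :=
    prod_congr rfl fun j _ => by push_cast; ring
  unfold genChoose
  rw [prod_range_succ', hprod, prod_range_succ, Nat.factorial_succ]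
  push_cast
  field_simp
  ring

/-- The binomial series `∑ C(n + b, n) yⁿ`, equal to `(1 - y)^(-(b + 1))`. -/
noncomputable def binomSeries (b : ℤ) : PowerSeries ℚ :=
  PowerSeries.mk fun n => genChoose (n + b) n

theorem binomSeries_mul_one_sub (b : ℤ) :
    binomSeries b * (1 - X) = binomSeries (b - 1) := by
  ext n
  rw [mul_sub, mul_one, map_sub]
  cases n with
  | zero => simp [binomSeries, genChoose]
  | succ n =>
    rw [coeff_succ_mul_X]
    simp only [binomSeries, coeff_mk]
    have h := genChoose_add_one_succ (n + b) n
    have h₁ : ((n + 1 : ℕ) : ℤ) + b = n + b + 1 := by push_cast; ring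
    have h₂ : ((n + 1 : ℕ) : ℤ) + (b - 1) = n + b := by push_cast; ring
    rw [h₁, h₂, h]
    ring

theorem binomSeries_mul_one_sub_pow (b : ℤ) (k : ℕ) :
    binomSeries b * (1 - X) ^ k = binomSeries (b - k) := by
  induction k with
  | zero => simp
  | succ k ih =>
    rw [pow_succ, ← mul_assoc, ih, binomSeries_mul_one_sub]
    congr 1
    push_cast
    ring

theorem binomSeries_neg_one : binomSeries (-1) = 1 := by
  ext n
  cases n with
  | zero => simp [binomSeries, genChoose]
  | succ n =>
    have h : ∏ j ∈ range (n + 1), ((n : ℚ) - j) = 0 := by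
      rw [prod_range_succ, sub_self, mul_zero]
    simp [binomSeries, genChoose, coeff_one, h]

theorem one_sub_mul_inv : (1 - X : PowerSeries ℚ) * (1 - X)⁻¹ = 1 :=
  PowerSeries.mul_inv_cancel _ (by simp)

theorem binomSeries_natCast_sub_one (k : ℕ) :
    binomSeries ((k : ℤ) - 1) = (1 - X : PowerSeries ℚ)⁻¹ ^ k := by
  have h := binomSeries_mul_one_sub_pow ((k : ℤ) - 1) k
  rw [show (k : ℤ) - 1 - k = -1 by ring, binomSeries_neg_one] at h
  calc binomSeries ((k : ℤ) - 1)
      = binomSeries ((k : ℤ) - 1) * ((1 - X) * (1 - X)⁻¹) ^ k := by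
        rw [one_sub_mul_inv, one_pow, mul_one]
    _ = (1 - X : PowerSeries ℚ)⁻¹ ^ k := by
        rw [mul_pow, ← mul_assoc, h, one_mul]

/-- The series `∑_{ℓ ≥ 2} (ℓ - 1) y^ℓ`. -/
noncomputable def nodeSeries : PowerSeries ℚ :=
  PowerSeries.mk fun ℓ => ((ℓ - 1 : ℕ) : ℚ)

theorem nodeSeries_eq : nodeSeries = X ^ 2 * (1 - X : PowerSeries ℚ)⁻¹ ^ 2 := by
  have h : nodeSeries * (1 - X) = X ^ 2 * PowerSeries.mk 1 := by
    ext n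
    rw [mul_sub, mul_one, map_sub, coeff_X_pow_mul']
    rcases n with _ | _ | n
    · simp [nodeSeries]
    · simp [nodeSeries, coeff_succ_mul_X]
    · rw [coeff_succ_mul_X]
      simp [nodeSeries]
  have h₁ := PowerSeries.mk_one_mul_one_sub_eq_one ℚ
  have h₂ := one_sub_mul_inv
  linear_combination (1 - X : PowerSeries ℚ)⁻¹ * h - nodeSeries * h₂ +
    X ^ 2 * (1 - X : PowerSeries ℚ)⁻¹ * ((1 - X : PowerSeries ℚ)⁻¹ * h₁ - PowerSeries.mk 1 * h₂)

theorem coeff_mul_nodeSeries_pow (F : PowerSeries ℚ) (d m : ℕ) :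
    coeff d (F * nodeSeries ^ m) =
      ∑ c ∈ piAntidiag (Icc 2 d) m,
        if ∑ ℓ ∈ Icc 2 d, ℓ * c ℓ ≤ d then
          (Nat.multinomial (Icc 2 d) c : ℚ) * (∏ ℓ ∈ Icc 2 d, ((ℓ : ℚ) - 1) ^ c ℓ) *
            coeff (d - ∑ ℓ ∈ Icc 2 d, ℓ * c ℓ) F
        else 0 := by
  set T : PowerSeries ℚ := ∑ ℓ ∈ Icc 2 d, C ((ℓ : ℚ) - 1) * X ^ ℓ with hT
  have hdvd : X ^ (d + 1) ∣ nodeSeries - T := by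
    rw [X_pow_dvd_iff]
    intro n hn
    rw [map_sub, hT, map_sum]
    simp only [coeff_C_mul_X_pow, sum_ite_eq, mem_Icc, nodeSeries, coeff_mk]
    split_ifs with h
    · rw [Nat.cast_sub (by omega)]
      simp
    · have : n - 1 = 0 := by omega
      simp [this]
  have hcoeff : coeff d (F * nodeSeries ^ m) = coeff d (F * T ^ m) := by
    rw [← sub_eq_zero, ← map_sub, ← mul_sub]
    exact X_pow_dvd_iff.mp
      (((hdvd.trans (sub_dvd_pow_sub_pow _ _ m)).mul_left F)) d (Nat.lt_succ_self d)
  rw [hcoeff, hT, sum_pow_eq_sum_piAntidiag, mul_sum, map_sum]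
  refine sum_congr rfl fun c _ => ?_
  have hmono : F * ((Nat.multinomial (Icc 2 d) c : PowerSeries ℚ) *
      ∏ ℓ ∈ Icc 2 d, (C ((ℓ : ℚ) - 1) * X ^ ℓ) ^ c ℓ) =
      C ((Nat.multinomial (Icc 2 d) c : ℚ) * ∏ ℓ ∈ Icc 2 d, ((ℓ : ℚ) - 1) ^ c ℓ) *
        (F * X ^ (∑ ℓ ∈ Icc 2 d, ℓ * c ℓ)) := by
    simp only [mul_pow, prod_mul_distrib, ← pow_mul, prod_pow_eq_pow_sum, map_mul, map_prod,
      map_pow, map_natCast]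
    ring
  rw [hmono, coeff_C_mul, coeff_mul_X_pow', mul_ite, mul_zero]

/-- The partition of `d` with `c ℓ` parts equal to `ℓ` for `2 ≤ ℓ ≤ d`, completed by ones. -/
def partitionOfCounts (d : ℕ) (c : ℕ → ℕ) (h : ∑ ℓ ∈ Icc 2 d, ℓ * c ℓ ≤ d) :
    Nat.Partition d where
  parts := Multiset.replicate (d - ∑ ℓ ∈ Icc 2 d, ℓ * c ℓ) 1 +
    ∑ ℓ ∈ Icc 2 d, Multiset.replicate (c ℓ) ℓ
  parts_pos := by
    intro i hi
    rw [Multiset.mem_add, Multiset.mem_sum] at hi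
    rcases hi with hi | ⟨ℓ, hℓ, hi⟩
    · rw [Multiset.eq_of_mem_replicate hi]
      exact one_pos
    · rw [Multiset.eq_of_mem_replicate hi]
      have := (mem_Icc.mp hℓ).1
      omega
  parts_sum := by
    rw [Multiset.sum_add, Multiset.sum_sum]
    simp only [Multiset.sum_replicate, smul_eq_mul, mul_one]
    rw [sum_congr rfl fun ℓ _ => mul_comm (c ℓ) ℓ]
    omega

theorem count_one_partitionOfCounts (d : ℕ) (c : ℕ → ℕ) (h : ∑ ℓ ∈ Icc 2 d, ℓ * c ℓ ≤ d) :
    (partitionOfCounts d c h).parts.count 1 = d - ∑ ℓ ∈ Icc 2 d, ℓ * c ℓ := by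
  simp [partitionOfCounts, Multiset.count_sum', Multiset.count_replicate]

theorem count_partitionOfCounts (d : ℕ) (c : ℕ → ℕ) (h : ∑ ℓ ∈ Icc 2 d, ℓ * c ℓ ≤ d)
    {ℓ : ℕ} (hℓ : ℓ ∈ Icc 2 d) : (partitionOfCounts d c h).parts.count ℓ = c ℓ := by
  have h1 : 1 ≠ ℓ := by
    have := (mem_Icc.mp hℓ).1
    omega
  simp only [partitionOfCounts, Multiset.count_add, Multiset.count_sum',
    Multiset.count_replicate, if_neg h1, zero_add, sum_ite_eq', if_pos hℓ]

theorem count_one_add_sum_count {d : ℕ} (lam : Nat.Partition d) :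
    lam.parts.count 1 + ∑ ℓ ∈ Icc 2 d, ℓ * lam.parts.count ℓ = d := by
  have hsub : lam.parts.toFinset ⊆ Icc 1 d := fun i hi => by
    rw [Multiset.mem_toFinset] at hi
    exact mem_Icc.mpr ⟨lam.parts_pos hi, lam.le_of_mem_parts hi⟩
  have hsum : ∑ ℓ ∈ Icc 1 d, lam.parts.count ℓ * ℓ = d := by
    have h := Finset.sum_multiset_count_of_subset lam.parts (Icc 1 d) hsub
    rw [lam.parts_sum] at h
    simpa using h.symm
  rcases Nat.eq_zero_or_pos d with rfl | hd
  · simp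
  · rw [← add_sum_Ioc_eq_sum_Icc hd,
      show Ioc 1 d = Icc 2 d by ext; simp only [mem_Ioc, mem_Icc]; omega] at hsum
    simp only [mul_comm _ (Multiset.count _ _)]
    simpa using hsum

theorem Nat.Partition.ext_count {d : ℕ} {lam mu : Nat.Partition d}
    (h : ∀ ℓ ∈ Icc 2 d, lam.parts.count ℓ = mu.parts.count ℓ) : lam = mu := by
  have h₁ := count_one_add_sum_count lam
  have h₂ := count_one_add_sum_count mu
  rw [sum_congr rfl fun ℓ hℓ => by rw [h ℓ hℓ]] at h₁
  refine Nat.Partition.ext (Multiset.ext.mpr fun ℓ => ?_)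
  by_cases hℓ : ℓ ∈ Icc 2 d
  · exact h ℓ hℓ
  · by_cases hone : ℓ = 1
    · subst hone
      omega
    · have key : ∀ nu : Nat.Partition d, nu.parts.count ℓ = 0 := fun nu => by
        rw [Multiset.count_eq_zero]
        intro hmem
        have := nu.parts_pos hmem
        have := nu.le_of_mem_parts hmem
        rw [mem_Icc] at hℓ
        omega
      rw [key, key]

theorem E_eq_coeff_sum (g δ d : ℕ) :
    E g δ d = coeff d (∑ m ∈ range (δ + 1),
      (δ.choose m : ℚ) • (binomSeries (1 + δ - m - 2 * g) * nodeSeries ^ m)) := by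
  simp only [map_sum, coeff_smul, coeff_mul_nodeSeries_pow, smul_eq_mul, mul_sum]
  unfold E
  rw [sum_sigma', ← sum_filter]
  rw [← sum_filter_of_ne (p := fun x : (_ : ℕ) × (ℕ → ℕ) => ∑ ℓ ∈ Icc 2 d, ℓ * x.2 ℓ ≤ d)
    (by
      intro x _ hx
      by_contra hlt
      simp [hlt] at hx)]
  refine sum_bij' (fun lam _ => (⟨kcheck d lam,
      fun ℓ => if ℓ ∈ Icc 2 d then lam.parts.count ℓ else 0⟩ : (_ : ℕ) × (ℕ → ℕ)))
    (fun x hx => partitionOfCounts d x.2 (mem_filter.mp hx).2) ?_ ?_ ?_ ?_ ?_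
  · intro lam hlam
    have hk := (mem_filter.mp hlam).2
    have hsum := count_one_add_sum_count lam
    simp only [mem_filter, mem_sigma, mem_range, mem_piAntidiag]
    refine ⟨⟨by omega, ?_, ?_⟩, ?_⟩
    · exact sum_congr rfl fun ℓ hℓ => if_pos hℓ
    · intro ℓ hℓ
      by_contra hn
      exact hℓ (if_neg hn)
    · rw [sum_congr rfl fun ℓ hℓ => by rw [if_pos hℓ]]
      omega
  · rintro ⟨m, c⟩ hx
    have hx' := hx
    simp only [mem_filter, mem_sigma, mem_range, mem_piAntidiag] at hx'
    rw [mem_filter]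
    refine ⟨mem_univ _, ?_⟩
    rw [kcheck, sum_congr rfl fun ℓ hℓ => count_partitionOfCounts d c _ hℓ, hx'.1.2.1]
    omega
  · intro lam hlam
    refine Nat.Partition.ext_count fun ℓ hℓ => ?_
    exact (count_partitionOfCounts _ _ _ hℓ).trans (if_pos hℓ)
  · rintro ⟨m, c⟩ hx
    have hx' := hx
    simp only [mem_filter, mem_sigma, mem_range, mem_piAntidiag] at hx'
    obtain ⟨⟨-, hsum, hsupp⟩, hle⟩ := hx'
    have hc : (fun ℓ => if ℓ ∈ Icc 2 d then (partitionOfCounts d c hle).parts.count ℓ else 0) =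
        c := by
      funext ℓ
      split_ifs with hℓ
      · exact count_partitionOfCounts d c hle hℓ
      · by_contra hne
        exact hℓ (hsupp ℓ (Ne.symm hne))
    have hm : kcheck d (partitionOfCounts d c hle) = m := by
      rw [kcheck, sum_congr rfl fun ℓ hℓ => count_partitionOfCounts d c hle hℓ, hsum]
    exact Sigma.ext hm (heq_of_eq hc)
  · intro lam hlam
    have hk := (mem_filter.mp hlam).2
    have hsum := count_one_add_sum_count lam
    have hcongr : ∀ {M : Type} [CommMonoid M] (f : ℕ → ℕ → M),
        ∏ ℓ ∈ Icc 2 d, f ℓ (if ℓ ∈ Icc 2 d then lam.parts.count ℓ else 0) =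
          ∏ ℓ ∈ Icc 2 d, f ℓ (lam.parts.count ℓ) :=
      fun f => prod_congr rfl fun ℓ hℓ => by rw [if_pos hℓ]
    have hw : ∑ ℓ ∈ Icc 2 d, ℓ * (if ℓ ∈ Icc 2 d then lam.parts.count ℓ else 0) =
        ∑ ℓ ∈ Icc 2 d, ℓ * lam.parts.count ℓ :=
      sum_congr rfl fun ℓ hℓ => by rw [if_pos hℓ]
    have hmult : Nat.multinomial (Icc 2 d)
        (fun ℓ => if ℓ ∈ Icc 2 d then lam.parts.count ℓ else 0) =
        Nat.multinomial (Icc 2 d) fun ℓ => lam.parts.count ℓ :=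
      Nat.multinomial_congr fun ℓ hℓ => if_pos hℓ
    have hspec : (∏ ℓ ∈ Icc 2 d, (Nat.factorial (lam.parts.count ℓ) : ℚ)) *
        Nat.multinomial (Icc 2 d) (fun ℓ => lam.parts.count ℓ) =
        Nat.factorial (kcheck d lam) := by
      exact_mod_cast Nat.multinomial_spec (Icc 2 d) fun ℓ => lam.parts.count ℓ
    have hchoose : (δ.choose (kcheck d lam) : ℚ) * Nat.factorial (kcheck d lam) *
        Nat.factorial (δ - kcheck d lam) = Nat.factorial δ := by
      exact_mod_cast Nat.choose_mul_factorial_mul_factorial hk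
    have hP : (∏ ℓ ∈ Icc 2 d, (Nat.factorial (lam.parts.count ℓ) : ℚ)) ≠ 0 :=
      prod_ne_zero_iff.mpr fun ℓ _ => by positivity
    have hQ : (Nat.factorial (δ - kcheck d lam) : ℚ) ≠ 0 := by positivity
    have hcoef : (Nat.factorial δ : ℚ) / ((Nat.factorial (δ - kcheck d lam) : ℚ) *
        ∏ ℓ ∈ Icc 2 d, (Nat.factorial (lam.parts.count ℓ) : ℚ)) =
        δ.choose (kcheck d lam) *
          Nat.multinomial (Icc 2 d) fun ℓ => lam.parts.count ℓ := by
      rw [div_eq_iff (mul_ne_zero hQ hP), ← hchoose, ← hspec]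
      ring
    have hone : d - ∑ ℓ ∈ Icc 2 d, ℓ * lam.parts.count ℓ = lam.parts.count 1 := by omega
    simp only [hw, hmult]
    rw [hcongr fun ℓ k => ((ℓ : ℚ) - 1) ^ k, if_pos (by omega), hone, hcoef, binomSeries,
      coeff_mk, Apart]
    have harg : (lam.parts.count 1 : ℤ) + 1 + δ - kcheck d lam - 2 * g =
        lam.parts.count 1 + (1 + δ - kcheck d lam - 2 * g) := by ring
    rw [harg]
    ring

/-- For `g ≥ δ ≥ 0`,
`∑_{d≥0} E(g,δ,d) y^d = (1-y)^{2g-2} (1 + y (1-y)^{-2})^δ` in `ℚ[[y]]`. -/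
theorem stmt_10 (g δ : ℕ) (hδg : δ ≤ g) :
    PowerSeries.mk (fun d => E g δ d) =
      (1 - PowerSeries.X : PowerSeries ℚ) ^ (2 * g) *
        ((1 - PowerSeries.X)⁻¹ : PowerSeries ℚ) ^ 2 *
        (1 + PowerSeries.X * ((1 - PowerSeries.X)⁻¹ : PowerSeries ℚ) ^ 2) ^ δ := by
  have hE : PowerSeries.mk (fun d => E g δ d) = ∑ m ∈ range (δ + 1),
      (δ.choose m : ℚ) • (binomSeries (1 + δ - m - 2 * g) * nodeSeries ^ m) := by
    ext d
    rw [coeff_mk, E_eq_coeff_sum]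
  have hinv := one_sub_mul_inv
  have hbase : (1 + X * (1 - X : PowerSeries ℚ)⁻¹ ^ 2) =
      (1 - X) * nodeSeries * (1 - X)⁻¹ + (1 - X)⁻¹ := by
    rw [nodeSeries_eq]
    generalize (1 - X : PowerSeries ℚ)⁻¹ = u at hinv
    linear_combination (-((1 - X) * u + 1) + u - X ^ 2 * u ^ 2) * hinv
  rw [hE, hbase, ← add_one_mul, mul_pow, add_pow, sum_mul, mul_sum]
  refine sum_congr rfl fun m _ => ?_
  have hb : binomSeries (1 + δ - m - 2 * g) =
      (1 - X : PowerSeries ℚ)⁻¹ ^ (δ + 2) * (1 - X) ^ (m + 2 * g) := by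
    rw [← binomSeries_natCast_sub_one, binomSeries_mul_one_sub_pow]
    congr 1
    push_cast
    ring
  rw [hb, smul_eq_C_mul, map_natCast]
  generalize (1 - X : PowerSeries ℚ)⁻¹ = u
  generalize (1 - X : PowerSeries ℚ) = v
  ring
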